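/- Optimization of the contraction factor: given positive constants ν, L, λ_M, λ̃_m, define for c > 0 and β ∈ (0,1), δ(β,c) = min{ 2βν/(cλ_M(1 + 2/λ̃_m)), (1−β)cλ̃_m/L }. Then max over β and c of δ is attained and equals δ* = (1/2)√( 2λ̃_m² / (λ_M(2 + λ̃_m)) · (ν/L) ), with the maximizing β* = c²λ_M(2+λ̃_m)/(2νL + c²λ_M(2+λ̃_m)) at the optimal c. -/

import Mathlib

theorem stmt18 (ν L lM lm : ℝ) (hν : 0 < ν) (hL : 0 < L) (hlM : 0 < lM) (hlm : 0 < lm) :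
    ∃ c : ℝ, 0 < c ∧
      c ^ 2 * lM * (2 + lm) / (2 * ν * L + c ^ 2 * lM * (2 + lm)) ∈ Set.Ioo (0 : ℝ) 1 ∧
      min (2 * (c ^ 2 * lM * (2 + lm) / (2 * ν * L + c ^ 2 * lM * (2 + lm))) * ν /
            (c * lM * (1 + 2 / lm)))
          ((1 - c ^ 2 * lM * (2 + lm) / (2 * ν * L + c ^ 2 * lM * (2 + lm))) * c * lm / L) =
        (1 / 2) * Real.sqrt (2 * lm ^ 2 / (lM * (2 + lm)) * (ν / L)) ∧
      IsGreatest {x : ℝ | ∃ c' > 0, ∃ β ∈ Set.Ioo (0 : ℝ) 1,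
          x = min (2 * β * ν / (c' * lM * (1 + 2 / lm))) ((1 - β) * c' * lm / L)}
        ((1 / 2) * Real.sqrt (2 * lm ^ 2 / (lM * (2 + lm)) * (ν / L))) := by
  have hK : 0 < lM * (2 + lm) := by positivity
  obtain ⟨c, hc, hcK⟩ : ∃ c : ℝ, 0 < c ∧ c ^ 2 * lM * (2 + lm) = 2 * ν * L := by
    refine ⟨√(2 * ν * L / (lM * (2 + lm))), by positivity, ?_⟩
    rw [Real.sq_sqrt (by positivity)]
    field_simp
  have hβ : c ^ 2 * lM * (2 + lm) / (2 * ν * L + c ^ 2 * lM * (2 + lm)) = 1 / 2 := by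
    rw [hcK]
    field_simp
    norm_num
  have hsqrt : √(2 * lm ^ 2 / (lM * (2 + lm)) * (ν / L)) = c * lm / L := by
    rw [Real.sqrt_eq_iff_mul_self_eq_of_pos (by positivity)]
    field_simp
    linear_combination hcK
  have hmin : min (2 * (1 / 2) * ν / (c * lM * (1 + 2 / lm))) ((1 - 1 / 2) * c * lm / L) =
      1 / 2 * (c * lm / L) := by
    have hfst : 2 * (1 / 2) * ν / (c * lM * (1 + 2 / lm)) = 1 / 2 * (c * lm / L) := by
      field_simp
      linear_combination -hcK
    have hsnd : (1 - 1 / 2) * c * lm / L = 1 / 2 * (c * lm / L) := by ring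
    rw [hfst, hsnd, min_self]
  have hmem : (1 / 2 : ℝ) ∈ Set.Ioo (0 : ℝ) 1 := by norm_num
  rw [hsqrt]
  refine ⟨c, hc, hβ ▸ hmem, by rw [hβ, hmin], ⟨c, hc, 1 / 2, hmem, hmin.symm⟩, ?_⟩
  rintro _ ⟨d, hd, β, ⟨hβ₀, hβ₁⟩, rfl⟩
  have hβ' : 0 < 1 - β := sub_pos.2 hβ₁
  have hprod : 2 * β * ν / (d * lM * (1 + 2 / lm)) * ((1 - β) * d * lm / L) =
      β * (1 - β) * (c * lm / L) ^ 2 := by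
    field_simp
    linear_combination -hcK
  by_contra! hlt
  obtain ⟨hfst, hsnd⟩ := lt_min_iff.1 hlt
  have hmul := mul_lt_mul'' hfst hsnd (by positivity) (by positivity)
  rw [hprod] at hmul
  nlinarith [mul_nonneg (sq_nonneg (β - 1 / 2)) (sq_nonneg (c * lm / L))]
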